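/- arXiv:2411.06341 — 2 statements merged into one kernel-verified Lean document; each statement's English description precedes it below -/
import Mathlib

section
/- Let X and Y be real Banach spaces, let T : (0,∞) → L(Y,X) be a family of bounded linear operators such that for every y ∈ Y the map τ ↦ T(τ)y is continuous on (0,∞) and ‖T(τ)‖ ≤ k(1 + τ^{−a})e^{−λτ} for all τ > 0 (with constants k > 0, λ > 0, a ∈ (0,1)), and let B : X × X → Y be a continuous bilinear map with ‖B(x,x')‖_Y ≤ c‖x‖_X‖x'‖_X. Set K̃ = k(1/λ + Γ(1−a)λ^{a−1}). For ω ∈ C_b(ℝ,X) and f ∈ C_b(ℝ,Y), let u(t) = ∫_{−∞}^t T(t−s)(B(ω(s),ω(s)) + f(s)) ds. Then for every real number T₀, sup_{t∈ℝ} ‖u(t+T₀) − u(t)‖_X ≤ K̃ (2c ‖ω‖_∞ · sup_{t∈ℝ}‖ω(t+T₀) − ω(t)‖_X + sup_{t∈ℝ}‖f(t+T₀) − f(t)‖_Y). -/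
open MeasureTheory Set Filter

noncomputable section

theorem aux_kernel (k lam a : ℝ) (hlam : 0 < lam) (ha : a ∈ Ioo (0:ℝ) 1) :
    IntegrableOn (fun τ : ℝ => k * (1 + τ ^ (-a)) * Real.exp (-lam * τ)) (Ioi 0) ∧
    ∫ τ in Ioi (0:ℝ), k * (1 + τ ^ (-a)) * Real.exp (-lam * τ) =
      k * (1 / lam + Real.Gamma (1 - a) * lam ^ (a - 1)) := by
  have h1a : 0 < 1 - a := by linarith [ha.2]
  have key1 := Real.integral_rpow_mul_exp_neg_mul_Ioi (a := 1) one_pos hlam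
  have key2 := Real.integral_rpow_mul_exp_neg_mul_Ioi h1a hlam
  have i1 : IntegrableOn (fun x : ℝ ↦ x ^ ((1 : ℝ) - 1) * Real.exp (-(lam * x))) (Ioi 0) :=
    .of_integral_ne_zero (by rw [key1]; simp [hlam.ne'])
  have i2 : IntegrableOn (fun x : ℝ ↦ x ^ ((1 - a : ℝ) - 1) * Real.exp (-(lam * x))) (Ioi 0) :=
    .of_integral_ne_zero (by
      rw [key2]
      have := Real.Gamma_pos_of_pos h1a
      positivity)
  have e : (fun τ : ℝ => k * (1 + τ ^ (-a)) * Real.exp (-lam * τ)) =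
      fun x => k * (x ^ ((1 : ℝ) - 1) * Real.exp (-(lam * x)) +
        x ^ ((1 - a : ℝ) - 1) * Real.exp (-(lam * x))) := by
    funext x
    have : (1 - a : ℝ) - 1 = -a := by ring
    rw [this]
    simp
    ring
  rw [e]
  refine ⟨(i1.add i2).const_mul k, ?_⟩
  rw [integral_const_mul, integral_add i1 i2, key1, key2]
  have : (1 / lam) ^ (1 - a) = lam ^ (a - 1) := by
    rw [one_div, Real.inv_rpow hlam.le, ← Real.rpow_neg hlam.le]
    ring_nf
  rw [this]
  simp
  ring_nf
  simp

theorem aux_cont {X Y : Type*} [NormedAddCommGroup X] [NormedSpace ℝ X]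
    [NormedAddCommGroup Y] [NormedSpace ℝ Y]
    (T : ℝ → Y →L[ℝ] X)
    (hTcont : ∀ y : Y, ContinuousOn (fun τ : ℝ => T τ y) (Ioi 0))
    (φ : ℝ → ℝ) (hφ : ContinuousOn φ (Ioi 0))
    (hT : ∀ τ : ℝ, 0 < τ → ‖T τ‖ ≤ φ τ) (g : ℝ → Y) (hg : Continuous g) :
    ContinuousOn (fun τ => T τ (g τ)) (Ioi 0) := by
  intro x hx
  have h1 : Tendsto (fun τ => T τ (g τ - g x)) (nhdsWithin x (Ioi 0)) (nhds 0) := by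
    have h2 : Tendsto (fun τ => φ τ * ‖g τ - g x‖) (nhdsWithin x (Ioi 0))
        (nhds (φ x * ‖g x - g x‖)) :=
      (hφ x hx).mul ((hg.sub continuous_const).norm.continuousWithinAt (x := x))
    simp only [sub_self, norm_zero, mul_zero] at h2
    refine squeeze_zero_norm' ?_ h2
    filter_upwards [self_mem_nhdsWithin] with τ hτ
    exact ((T τ).le_opNorm _).trans
      (mul_le_mul_of_nonneg_right (hT τ hτ) (norm_nonneg _))
  have h3 := h1.add (hTcont (g x) x hx)
  simp only [map_sub, sub_add_cancel, zero_add] at h3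
  exact h3

theorem aux_shift {X : Type*} [NormedAddCommGroup X] [NormedSpace ℝ X] (F : ℝ → ℝ → X) (t : ℝ) :
    ∫ s in Iio t, F (t - s) s = ∫ τ in Ioi (0:ℝ), F τ (t - τ) := by
  rw [← integral_indicator measurableSet_Iio, ← integral_indicator measurableSet_Ioi,
    ← integral_sub_left_eq_self _ volume t]
  congr 1
  funext s
  by_cases h : 0 < s
  · rw [indicator_of_mem (by simpa using h), indicator_of_mem (by simpa using h)]
    simp
  · rw [indicator_of_notMem (by simpa using h), indicator_of_notMem (by simpa using h)]

theorem stmt5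
    {X Y : Type*} [NormedAddCommGroup X] [NormedSpace ℝ X] [CompleteSpace X]
    [NormedAddCommGroup Y] [NormedSpace ℝ Y]
    (T : ℝ → Y →L[ℝ] X)
    (hTcont : ∀ y : Y, ContinuousOn (fun τ : ℝ => T τ y) (Ioi 0))
    (k lam a c : ℝ) (hk : 0 < k) (hlam : 0 < lam) (ha : a ∈ Ioo (0:ℝ) 1)
    (hT : ∀ τ : ℝ, 0 < τ → ‖T τ‖ ≤ k * (1 + τ ^ (-a)) * Real.exp (-lam * τ))
    (B : X →L[ℝ] X →L[ℝ] Y)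
    (hB : ∀ x x' : X, ‖B x x'‖ ≤ c * ‖x‖ * ‖x'‖)
    (ω : BoundedContinuousFunction ℝ X) (f : BoundedContinuousFunction ℝ Y)
    (u : ℝ → X)
    (hu : ∀ t : ℝ, u t = ∫ s in Iio t, T (t - s) (B (ω s) (ω s) + f s)) :
    ∀ T₀ t : ℝ, ‖u (t + T₀) - u t‖ ≤
      k * (1 / lam + Real.Gamma (1 - a) * lam ^ (a - 1)) *
        (2 * c * ‖ω‖ * (⨆ s : ℝ, ‖ω (s + T₀) - ω s‖) +
          ⨆ s : ℝ, ‖f (s + T₀) - f s‖) := by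
  intro T₀ t
  set φ : ℝ → ℝ := fun τ => k * (1 + τ ^ (-a)) * Real.exp (-lam * τ) with hφdef
  obtain ⟨hφi, hφv⟩ := aux_kernel k lam a hlam ha
  have hφc : ContinuousOn φ (Ioi 0) := by
    have : ContinuousOn (fun τ : ℝ => τ ^ (-a)) (Ioi 0) := fun x hx =>
      (Real.continuousAt_rpow_const x (-a) (Or.inl (ne_of_gt hx))).continuousWithinAt
    exact (continuousOn_const.mul (continuousOn_const.add this)).mul
      (by fun_prop)
  set g : ℝ → Y := fun s => B (ω s) (ω s) + f s with hgdef
  have hg : Continuous g := by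
    have h1 := ω.continuous
    have h2 := f.continuous
    exact ((B.continuous.comp h1).clm_apply h1).add h2
  have hgb : ∀ s, ‖g s‖ ≤ ‖B‖ * ‖ω‖ * ‖ω‖ + ‖f‖ := by
    intro s
    refine (norm_add_le _ _).trans (add_le_add ?_ (f.norm_coe_le_norm s))
    refine (B.le_opNorm₂ _ _).trans ?_
    have := ω.norm_coe_le_norm s
    gcongr
  have hint : ∀ t : ℝ, IntegrableOn (fun τ => T τ (g (t - τ))) (Ioi 0) := by
    intro t
    refine Integrable.mono' (hφi.mul_const (‖B‖ * ‖ω‖ * ‖ω‖ + ‖f‖)) ?_ ?_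
    · exact (aux_cont T hTcont φ hφc hT _
        (hg.comp (continuous_const.sub continuous_id))).aestronglyMeasurable measurableSet_Ioi
    · filter_upwards [ae_restrict_mem measurableSet_Ioi] with τ hτ
      exact ((T τ).le_opNorm _).trans (mul_le_mul (hT τ hτ) (hgb _) (norm_nonneg _)
        ((norm_nonneg _).trans (hT τ hτ)))
  have hu' : ∀ t, u t = ∫ τ in Ioi (0:ℝ), T τ (g (t - τ)) := fun t => by
    rw [hu t]; exact aux_shift (fun τ s => T τ (g s)) t
  set D := ⨆ s : ℝ, ‖ω (s + T₀) - ω s‖ with hD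
  set E := ⨆ s : ℝ, ‖f (s + T₀) - f s‖ with hE
  have hDs : ∀ s, ‖ω (s + T₀) - ω s‖ ≤ D := fun s =>
    le_ciSup (f := fun s => ‖ω (s + T₀) - ω s‖) ⟨‖ω‖ + ‖ω‖, by
      rintro _ ⟨s, rfl⟩
      exact (norm_sub_le _ _).trans
        (add_le_add (ω.norm_coe_le_norm _) (ω.norm_coe_le_norm _))⟩ s
  have hEs : ∀ s, ‖f (s + T₀) - f s‖ ≤ E := fun s =>
    le_ciSup (f := fun s => ‖f (s + T₀) - f s‖) ⟨‖f‖ + ‖f‖, by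
      rintro _ ⟨s, rfl⟩
      exact (norm_sub_le _ _).trans
        (add_le_add (f.norm_coe_le_norm _) (f.norm_coe_le_norm _))⟩ s
  have hgd : ∀ s, ‖g (s + T₀) - g s‖ ≤ 2 * c * ‖ω‖ * D + E := by
    intro s
    have e : g (s + T₀) - g s = (B (ω (s + T₀) - ω s) (ω (s + T₀)) +
        B (ω s) (ω (s + T₀) - ω s)) + (f (s + T₀) - f s) := by
      simp only [hgdef, map_sub, ContinuousLinearMap.sub_apply]
      abel
    rw [e]
    refine (norm_add_le _ _).trans (add_le_add ?_ (hEs s))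
    refine (norm_add_le _ _).trans ((add_le_add (hB _ _) (hB _ _)).trans ?_)
    by_cases hc : 0 ≤ c
    · have h1 := ω.norm_coe_le_norm s
      have h2 := ω.norm_coe_le_norm (s + T₀)
      have h3 := hDs s
      have h0 : 0 ≤ D := (norm_nonneg _).trans h3
      calc _ ≤ c * D * ‖ω‖ + c * ‖ω‖ * D := by gcongr
        _ = _ := by ring
    · have hz : ∀ x : X, x = 0 := by
        intro x
        have h1 := (norm_nonneg _).trans (hB x x)
        by_contra hx
        have h2 : 0 < ‖x‖ := norm_pos_iff.mpr hx
        have : 0 < ‖x‖ * ‖x‖ := mul_pos h2 h2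
        nlinarith
      have hω : ω = 0 := by ext s; exact hz _
      simp [hω]
  rw [hu', hu', ← integral_sub (hint _) (hint _), ← hφv, ← integral_mul_const]
  refine norm_integral_le_of_norm_le (hφi.mul_const _) ?_
  filter_upwards [ae_restrict_mem measurableSet_Ioi] with τ hτ
  rw [← map_sub, show t + T₀ - τ = (t - τ) + T₀ by ring]
  exact ((T τ).le_opNorm _).trans (mul_le_mul (hT τ hτ) (hgd _) (norm_nonneg _)
    ((norm_nonneg _).trans (hT τ hτ)))
end
end

section
/- Let X and Y be real Banach spaces and let T : (0,∞) → L(Y,X) be a family of bounded linear operators such that for every y ∈ Y the map τ ↦ T(τ)y is continuous on (0,∞) and ‖T(τ)‖ ≤ k(1 + τ^{−a})e^{−λτ} for all τ > 0 (with constants k > 0, λ > 0, a ∈ (0,1)). If f₂ ∈ PAP₀(ℝ,Y), then the function v(t) = ∫_{−∞}^t T(t−s) f₂(s) ds is a well-defined bounded continuous function ℝ → X belonging to PAP₀(ℝ,X), i.e. lim_{L→∞} (1/(2L)) ∫_{−L}^{L} ‖v(t)‖_X dt = 0. -/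
open MeasureTheory Set Filter

noncomputable section

/-- A bounded continuous function `φ : ℝ → Z` with vanishing mean value. -/
def IsPAP0 {Z : Type*} [NormedAddCommGroup Z] (φ : ℝ → Z) : Prop :=
  Continuous φ ∧ (∃ C : ℝ, ∀ t : ℝ, ‖φ t‖ ≤ C) ∧
    Tendsto (fun L : ℝ => (1 / (2 * L)) * ∫ t in (-L)..L, ‖φ t‖) atTop (nhds 0)

private lemma aux_contOn {X Y : Type*} [NormedAddCommGroup X] [NormedSpace ℝ X]
    [NormedAddCommGroup Y] [NormedSpace ℝ Y]
    (T : ℝ → Y →L[ℝ] X) (hTcont : ∀ y : Y, ContinuousOn (fun τ : ℝ => T τ y) (Ioi 0))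
    (K : ℝ → ℝ) (hK : ContinuousOn K (Ioi 0)) (hT : ∀ τ : ℝ, 0 < τ → ‖T τ‖ ≤ K τ)
    (g : ℝ → Y) (hg : Continuous g) : ContinuousOn (fun τ => T τ (g τ)) (Ioi 0) := by
  intro x hx
  have h1 : Tendsto (fun τ => T τ (g τ - g x)) (nhdsWithin x (Ioi 0)) (nhds 0) := by
    refine squeeze_zero_norm' (a := fun τ => K τ * ‖g τ - g x‖) ?_ ?_
    · filter_upwards [self_mem_nhdsWithin] with τ hτ
      exact (T τ).le_of_opNorm_le (hT τ hτ) _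
    · have h2 : Tendsto (fun τ => ‖g τ - g x‖) (nhdsWithin x (Ioi 0)) (nhds 0) := by
        have : Continuous (fun τ => ‖g τ - g x‖) := by fun_prop
        have h3 := this.tendsto x
        simp only [sub_self, norm_zero] at h3
        exact h3.mono_left nhdsWithin_le_nhds
      have h4 := (hK x hx).tendsto.mul h2
      rwa [mul_zero] at h4
  have h5 := h1.add (hTcont (g x) x hx).tendsto
  simp only [map_sub, sub_add_cancel, zero_add] at h5
  exact h5

private lemma aux_K (k lam a : ℝ) (hlam : 0 < lam) (ha : a ∈ Ioo (0:ℝ) 1) :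
    IntegrableOn (fun τ : ℝ => k * (1 + τ ^ (-a)) * Real.exp (-lam * τ)) (Ioi 0) := by
  have h1 := integrableOn_rpow_mul_exp_neg_mul_rpow (p := 1) (s := -a) (b := lam)
    (by linarith [ha.2]) one_pos hlam
  have h2 := integrableOn_rpow_mul_exp_neg_mul_rpow (p := 1) (s := 0) (b := lam)
    (by norm_num) one_pos hlam
  refine ((h2.add h1).const_mul k).congr ?_
  refine Filter.Eventually.of_forall fun x => ?_
  simp only [Real.rpow_zero, Real.rpow_one, Pi.add_apply]
  ring

private lemma aux_shift_s8 {Y : Type*} [NormedAddCommGroup Y] (f : ℝ → Y) (hf : IsPAP0 f)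
    (τ : ℝ) (hτ : 0 < τ) :
    Tendsto (fun L : ℝ => (1 / (2 * L)) * ∫ t in (-L)..L, ‖f (t - τ)‖) atTop (nhds 0) := by
  obtain ⟨hc, -, ht⟩ := hf
  have h1 := ht.comp (tendsto_atTop_add_const_right atTop τ tendsto_id)
  have h2 : Tendsto (fun L : ℝ => 1 + τ * L⁻¹) atTop (nhds (1 + τ * 0)) :=
    (tendsto_inv_atTop_zero.const_mul τ).const_add 1
  have h3 := h2.mul h1
  rw [mul_zero] at h3
  refine squeeze_zero' ?_ ?_ h3
  · filter_upwards [eventually_gt_atTop 0] with L hL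
    have : 0 ≤ ∫ t in (-L)..L, ‖f (t - τ)‖ :=
      intervalIntegral.integral_nonneg (by linarith) (fun _ _ => norm_nonneg _)
    positivity
  · filter_upwards [eventually_gt_atTop 0] with L hL
    have e : ∫ t in (-L)..L, ‖f (t - τ)‖ ≤ ∫ t in (-(L + τ))..(L + τ), ‖f t‖ := by
      rw [intervalIntegral.integral_comp_sub_right (fun t => ‖f t‖) τ]
      refine intervalIntegral.integral_mono_interval (by linarith) (by linarith) (by linarith)
        (Filter.Eventually.of_forall fun _ => norm_nonneg _) (hc.norm.intervalIntegrable _ _)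
    simp only [Function.comp_apply, id_eq]
    calc (1 / (2 * L)) * ∫ t in (-L)..L, ‖f (t - τ)‖
        ≤ (1 / (2 * L)) * ∫ t in (-(L + τ))..(L + τ), ‖f t‖ := by gcongr
      _ = _ := by
        have : L + τ ≠ 0 := by positivity
        field_simp

theorem stmt8
    {X Y : Type*} [NormedAddCommGroup X] [NormedSpace ℝ X] [CompleteSpace X]
    [NormedAddCommGroup Y] [NormedSpace ℝ Y]
    (T : ℝ → Y →L[ℝ] X)
    (hTcont : ∀ y : Y, ContinuousOn (fun τ : ℝ => T τ y) (Ioi 0))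
    (k lam a : ℝ) (hk : 0 < k) (hlam : 0 < lam) (ha : a ∈ Ioo (0:ℝ) 1)
    (hT : ∀ τ : ℝ, 0 < τ → ‖T τ‖ ≤ k * (1 + τ ^ (-a)) * Real.exp (-lam * τ))
    (f₂ : ℝ → Y) (hf₂ : IsPAP0 f₂) :
    (∀ t : ℝ, IntegrableOn (fun s : ℝ => T (t - s) (f₂ s)) (Iio t)) ∧
    IsPAP0 (fun t : ℝ => ∫ s in Iio t, T (t - s) (f₂ s)) := by
  set K : ℝ → ℝ := fun τ => k * (1 + τ ^ (-a)) * Real.exp (-lam * τ) with hKdef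
  have hKi : IntegrableOn K (Ioi 0) := aux_K k lam a hlam ha
  have hKc : ContinuousOn K (Ioi 0) := by
    intro x hx
    have hx0 : x ≠ 0 := ne_of_gt hx
    have : ContinuousAt (fun τ : ℝ => τ ^ (-a)) x := Real.continuousAt_rpow_const _ _ (Or.inl hx0)
    exact ContinuousAt.continuousWithinAt (by fun_prop)
  have hKm : Measurable K := by fun_prop
  have hf := hf₂
  obtain ⟨hc, ⟨C, hC⟩, -⟩ := hf₂
  have hK0 : ∀ τ : ℝ, 0 < τ → 0 ≤ K τ := fun τ hτ => (norm_nonneg _).trans (hT τ hτ)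
  have hco : ∀ t : ℝ, ContinuousOn (fun τ => T τ (f₂ (t - τ))) (Ioi 0) := fun t =>
    aux_contOn T hTcont K hKc hT _ (by fun_prop)
  have hm : ∀ t : ℝ, AEStronglyMeasurable (fun τ => T τ (f₂ (t - τ)))
      (volume.restrict (Ioi 0)) := fun t => (hco t).aestronglyMeasurable measurableSet_Ioi
  have hb1 : ∀ t τ : ℝ, 0 < τ → ‖T τ (f₂ (t - τ))‖ ≤ K τ * ‖f₂ (t - τ)‖ := fun t τ hτ =>
    (T τ).le_of_opNorm_le (hT τ hτ) _
  have hb2 : ∀ t τ : ℝ, 0 < τ → K τ * ‖f₂ (t - τ)‖ ≤ K τ * C := fun t τ hτ =>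
    mul_le_mul_of_nonneg_left (hC _) (hK0 τ hτ)
  have hKC : Integrable (fun τ => K τ * C) (volume.restrict (Ioi 0)) := hKi.mul_const C
  have hI : ∀ t : ℝ, IntegrableOn (fun τ => T τ (f₂ (t - τ))) (Ioi 0) := fun t =>
    hKC.mono' (hm t) ((ae_restrict_mem measurableSet_Ioi).mono fun τ hτ =>
      (hb1 t τ hτ).trans (hb2 t τ hτ))
  have hKf : ∀ t : ℝ, IntegrableOn (fun τ => K τ * ‖f₂ (t - τ)‖) (Ioi 0) := fun t =>
    hKC.mono' (hKm.aestronglyMeasurable.mul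
      (Continuous.aestronglyMeasurable (by fun_prop)))
      ((ae_restrict_mem measurableSet_Ioi).mono fun τ hτ => by
        rw [Real.norm_of_nonneg (mul_nonneg (hK0 τ hτ) (norm_nonneg _))]
        exact hb2 t τ hτ)
  have hpre : ∀ t : ℝ, (fun s => t - s) ⁻¹' (Ioi 0) = Iio t := fun t => by
    ext s; simp
  have hmp : ∀ t : ℝ, MeasurePreserving (fun s : ℝ => t - s) volume volume := fun t =>
    Measure.measurePreserving_sub_left volume t
  have hme : ∀ t : ℝ, MeasurableEmbedding (fun s : ℝ => t - s) := fun t =>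
    (Homeomorph.subLeft t).measurableEmbedding
  have hv : ∀ t : ℝ, ∫ s in Iio t, T (t - s) (f₂ s) = ∫ τ in Ioi 0, T τ (f₂ (t - τ)) := by
    intro t
    have := (hmp t).setIntegral_preimage_emb (hme t) (fun τ => T τ (f₂ (t - τ))) (Ioi 0)
    rw [hpre] at this
    simpa only [sub_sub_cancel] using this
  refine ⟨fun t => ?_, ?_⟩
  · have := ((hmp t).integrableOn_comp_preimage (hme t)).2 (hI t)
    rw [hpre] at this
    simpa only [Function.comp_def, sub_sub_cancel] using this
  simp only [hv]
  have hvc : Continuous (fun t => ∫ τ in Ioi 0, T τ (f₂ (t - τ))) := by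
    refine continuous_of_dominated (bound := fun τ => K τ * C) hm ?_ hKC ?_
    · exact fun t => (ae_restrict_mem measurableSet_Ioi).mono fun τ hτ =>
        (hb1 t τ hτ).trans (hb2 t τ hτ)
    · exact Filter.Eventually.of_forall fun τ => by fun_prop
  refine ⟨hvc, ⟨∫ τ in Ioi 0, K τ * C, fun t => ?_⟩, ?_⟩
  · exact norm_integral_le_of_norm_le hKC ((ae_restrict_mem measurableSet_Ioi).mono fun τ hτ =>
        (hb1 t τ hτ).trans (hb2 t τ hτ))
  have hlim : Tendsto (fun L : ℝ => ∫ τ in Ioi 0,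
      K τ * ((1 / (2 * L)) * ∫ t in (-L)..L, ‖f₂ (t - τ)‖)) atTop (nhds 0) := by
    have h0 : (0:ℝ) = ∫ τ in Ioi (0:ℝ), (0:ℝ) := by simp
    suffices h : Tendsto (fun L : ℝ => ∫ τ in Ioi 0,
        K τ * ((1 / (2 * L)) * ∫ t in (-L)..L, ‖f₂ (t - τ)‖)) atTop
        (nhds (∫ τ in Ioi (0:ℝ), (0:ℝ))) by
      rwa [← h0] at h
    refine tendsto_integral_filter_of_dominated_convergence (fun τ => K τ * C) ?_ ?_ hKC ?_
    · refine Filter.Eventually.of_forall fun L => ?_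
      refine hKm.aestronglyMeasurable.mul (Continuous.aestronglyMeasurable ?_)
      refine continuous_const.mul ?_
      exact intervalIntegral.continuous_parametric_intervalIntegral_of_continuous'
        (by simp only [Function.uncurry_def]; fun_prop) _ _
    · filter_upwards [eventually_gt_atTop 0] with L hL
      refine (ae_restrict_mem measurableSet_Ioi).mono fun τ hτ => ?_
      rw [norm_mul, Real.norm_of_nonneg (hK0 τ hτ)]
      refine mul_le_mul_of_nonneg_left ?_ (hK0 τ hτ)
      have h1 := intervalIntegral.norm_integral_le_of_norm_le_const (a := -L) (b := L)
        (f := fun t => ‖f₂ (t - τ)‖) (C := C) (fun t _ => by simpa using hC (t - τ))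
      rw [norm_mul, Real.norm_of_nonneg (by positivity : 0 ≤ 1 / (2 * L))]
      calc _ ≤ 1 / (2 * L) * (C * |L - -L|) := by gcongr
        _ = C := by
          rw [abs_of_pos (by linarith)]
          field_simp
          ring
    · refine (ae_restrict_mem measurableSet_Ioi).mono fun τ hτ => ?_
      have := (aux_shift_s8 f₂ hf τ hτ).const_mul (K τ)
      rwa [mul_zero] at this
  refine squeeze_zero' ?_ ?_ hlim
  · filter_upwards [eventually_gt_atTop 0] with L hL
    have : 0 ≤ ∫ t in (-L)..L, ‖∫ τ in Ioi 0, T τ (f₂ (t - τ))‖ :=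
      intervalIntegral.integral_nonneg (by linarith) (fun _ _ => norm_nonneg _)
    positivity
  · filter_upwards [eventually_gt_atTop 0] with L hL
    have hP : Integrable (Function.uncurry fun t τ : ℝ => K τ * ‖f₂ (t - τ)‖)
        ((volume.restrict (Ioc (-L) L)).prod (volume.restrict (Ioi 0))) := by
      have h1 : Integrable (fun z : ℝ × ℝ => (1:ℝ) * (K z.2 * C))
          ((volume.restrict (Ioc (-L) L)).prod (volume.restrict (Ioi 0))) :=
        Integrable.mul_prod (f := fun _ : ℝ => (1:ℝ)) (integrable_const _) hKC
      refine h1.mono' ?_ ?_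
      · exact (hKm.comp measurable_snd).aestronglyMeasurable.mul
          (Continuous.aestronglyMeasurable (by fun_prop))
      · rw [Measure.prod_restrict]
        refine (ae_restrict_mem (measurableSet_Ioc.prod measurableSet_Ioi)).mono fun z hz => ?_
        have hz2 : 0 < z.2 := hz.2
        simp only [Function.uncurry_def, one_mul]
        rw [Real.norm_of_nonneg (mul_nonneg (hK0 _ hz2) (norm_nonneg _))]
        exact hb2 _ _ hz2
    have hle : -L ≤ L := by linarith
    have h2 : ∫ t in (-L)..L, ‖∫ τ in Ioi 0, T τ (f₂ (t - τ))‖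
        ≤ ∫ t in (-L)..L, ∫ τ in Ioi 0, K τ * ‖f₂ (t - τ)‖ := by
      refine intervalIntegral.integral_mono_on hle (hvc.norm.intervalIntegrable _ _) ?_ ?_
      · rw [intervalIntegrable_iff_integrableOn_Ioc_of_le hle]
        exact hP.integral_prod_left
      · intro t _
        exact norm_integral_le_of_norm_le (hKf t)
          ((ae_restrict_mem measurableSet_Ioi).mono fun τ hτ => hb1 t τ hτ)
    have h3 : ∫ t in (-L)..L, ∫ τ in Ioi 0, K τ * ‖f₂ (t - τ)‖
        = ∫ τ in Ioi 0, K τ * ∫ t in (-L)..L, ‖f₂ (t - τ)‖ := by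
      simp only [intervalIntegral.integral_of_le hle]
      rw [integral_integral_swap hP]
      simp only [integral_const_mul]
    calc _ ≤ (1 / (2 * L)) * ∫ τ in Ioi 0, K τ * ∫ t in (-L)..L, ‖f₂ (t - τ)‖ := by
          rw [← h3]; gcongr
      _ = _ := by
          rw [← integral_const_mul]
          congr 1
          ext τ
          ring
end
end
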